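/- Let I be an isotropic subspace with value assignment γ and let b ∉ I. Then Π_b^r Π_I^γ Π_b^r = (|I(b)|/|I|) Π_{I(b)⊕⟨b⟩}^{γ∗r}, where I(b) = I ∩ ⟨b⟩^⊥ and γ∗r is the value assignment extending γ|_{I(b)} by γ∗r(b) = r. -/

import Mathlib

abbrev PhaseSpace (n : ℕ) := (Fin n → ZMod 2) × (Fin n → ZMod 2)

def symplOmega {n : ℕ} (a b : PhaseSpace n) : ZMod 2 :=
  ∑ j, (a.1 j * b.2 j + b.1 j * a.2 j)

/-- The `n`-qubit Pauli operator `T_a` in the computational basis. -/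
def PauliT {n : ℕ} (a : PhaseSpace n) :
    Matrix (Fin n → ZMod 2) (Fin n → ZMod 2) ℂ := fun s t =>
  Complex.I ^ (∑ j, (a.1 j * a.2 j).val) *
    ∏ j, if s j = t j + a.1 j then ((-1 : ℂ) ^ (a.2 j * t j).val) else 0

open scoped Classical in
/-- The operator `Π_I^γ = (1/|I|) Σ_{a ∈ I} (-1)^{γ(a)} T_a`. -/
noncomputable def stabProj {n : ℕ} (I : Submodule (ZMod 2) (PhaseSpace n))
    (γ : PhaseSpace n → ZMod 2) : Matrix (Fin n → ZMod 2) (Fin n → ZMod 2) ℂ :=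
  ((Nat.card I : ℂ))⁻¹ • ∑ a : PhaseSpace n,
    if a ∈ I then ((-1 : ℂ) ^ (γ a).val) • PauliT a else 0
/-- For fixed `b`, the map `a ↦ ω(a,b)` is linear. -/
def symplOmegaLin {n : ℕ} (b : PhaseSpace n) : PhaseSpace n →ₗ[ZMod 2] ZMod 2 where
  toFun a := symplOmega a b
  map_add' a a' := by
    simp only [symplOmega]
    rw [← Finset.sum_add_distrib]
    refine Finset.sum_congr rfl fun j _ => ?_
    simp only [Prod.fst_add, Prod.snd_add, Pi.add_apply]
    ring
  map_smul' r a := by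
    simp only [symplOmega, RingHom.id_apply, smul_eq_mul]
    rw [Finset.mul_sum]
    refine Finset.sum_congr rfl fun j _ => ?_
    simp only [Prod.smul_fst, Prod.smul_snd, Pi.smul_apply, smul_eq_mul]
    ring

/-- The symplectic complement `J^⊥ = {a : ω(a,c) = 0 for all c ∈ J}`. -/
def symplPerp {n : ℕ} (J : Submodule (ZMod 2) (PhaseSpace n)) :
    Submodule (ZMod 2) (PhaseSpace n) :=
  ⨅ c ∈ J, LinearMap.ker (symplOmegaLin c)

/-- The Pauli projector `Π_b^r = (1 + (-1)^r T_b)/2`. -/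
noncomputable def pauliProj {n : ℕ} (b : PhaseSpace n) (r : ZMod 2) :
    Matrix (Fin n → ZMod 2) (Fin n → ZMod 2) ℂ :=
  (2 : ℂ)⁻¹ • ((1 : Matrix (Fin n → ZMod 2) (Fin n → ZMod 2) ℂ) + ((-1 : ℂ) ^ r.val) • PauliT b)

/-- The sign `(-1)^x` is multiplicative in `x : ZMod 2`. -/
theorem neg_one_pow_val_add (x y : ZMod 2) :
    (-1 : ℂ) ^ (x + y).val = (-1) ^ x.val * (-1) ^ y.val := by
  rw [ZMod.val_add, ← neg_one_pow_eq_pow_mod_two, pow_add]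

theorem neg_one_pow_val_sum {ι : Type*} (s : Finset ι) (f : ι → ZMod 2) :
    (-1 : ℂ) ^ (∑ j ∈ s, f j).val = ∏ j ∈ s, (-1 : ℂ) ^ (f j).val := by
  classical
  induction s using Finset.induction_on with
  | empty => simp
  | insert a s ha ih => rw [Finset.sum_insert ha, Finset.prod_insert ha, neg_one_pow_val_add, ih]

theorem PauliT_apply {n : ℕ} (a : PhaseSpace n) (s t : Fin n → ZMod 2) :
    PauliT a s t = Complex.I ^ (∑ j, (a.1 j * a.2 j).val) *
      if s = t + a.1 then (-1 : ℂ) ^ (∑ j, a.2 j * t j).val else 0 := by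
  unfold PauliT
  congr 1
  split_ifs with h
  · rw [neg_one_pow_val_sum]
    exact Finset.prod_congr rfl fun j _ => by simp [h]
  · obtain ⟨j, hj⟩ := Function.ne_iff.mp h
    exact Finset.prod_eq_zero (Finset.mem_univ j) (if_neg hj)

theorem PauliT_zero {n : ℕ} : PauliT (0 : PhaseSpace n) = 1 := by
  ext s t
  simp [PauliT_apply, Matrix.one_apply]

theorem PauliT_mul_apply {n : ℕ} (a b : PhaseSpace n) (s t : Fin n → ZMod 2) :
    (PauliT a * PauliT b) s t =
      Complex.I ^ (∑ j, (a.1 j * a.2 j).val) * Complex.I ^ (∑ j, (b.1 j * b.2 j).val) *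
        if s = t + b.1 + a.1 then
          (-1 : ℂ) ^ (∑ j, a.2 j * (t j + b.1 j) + ∑ j, b.2 j * t j).val else 0 := by
  rw [Matrix.mul_apply, Finset.sum_eq_single (t + b.1)]
  · simp only [PauliT_apply, if_true, neg_one_pow_val_add, Pi.add_apply]
    split_ifs <;> ring
  · intro u _ hu
    simp [PauliT_apply b, hu]
  · simp

theorem PauliT_mul_comm {n : ℕ} (a b : PhaseSpace n) :
    PauliT b * PauliT a = ((-1 : ℂ) ^ (symplOmega a b).val) • (PauliT a * PauliT b) := by
  ext s t
  rw [Matrix.smul_apply, PauliT_mul_apply, PauliT_mul_apply, smul_eq_mul, add_right_comm]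
  have hexp : ∑ j, b.2 j * (t j + a.1 j) + ∑ j, a.2 j * t j =
      symplOmega a b + (∑ j, a.2 j * (t j + b.1 j) + ∑ j, b.2 j * t j) := by
    simp only [symplOmega, ← Finset.sum_add_distrib]
    refine Finset.sum_congr rfl fun j _ => ?_
    linear_combination -(b.1 j * a.2 j) * (CharTwo.two_eq_zero : (2 : ZMod 2) = 0)
  rw [hexp, neg_one_pow_val_add (symplOmega a b)]
  split_ifs <;> ring

theorem symplOmega_self {n : ℕ} (b : PhaseSpace n) : symplOmega b b = 0 :=
  Finset.sum_eq_zero fun _ _ => CharTwo.add_self_eq_zero _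

theorem mem_symplPerp_span_singleton {n : ℕ} (a b : PhaseSpace n) :
    a ∈ symplPerp (Submodule.span (ZMod 2) {b}) ↔ symplOmega a b = 0 := by
  simp only [symplPerp, Submodule.mem_iInf, LinearMap.mem_ker]
  constructor
  · exact fun h => h b (Submodule.mem_span_singleton_self b)
  · intro h c hc
    obtain ⟨k, rfl⟩ := Submodule.mem_span_singleton.mp hc
    have hk : symplOmegaLin (k • b) a = k * symplOmega a b := by
      simp only [symplOmegaLin, LinearMap.coe_mk, AddHom.coe_mk, symplOmega, Finset.mul_sum]
      refine Finset.sum_congr rfl fun j _ => ?_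
      simp only [Prod.smul_fst, Prod.smul_snd, Pi.smul_apply, smul_eq_mul]
      ring
    rw [hk, h, mul_zero]

/-- Over `ZMod 2` the span of `J` and `b` consists of the cosets `J` and `J + b`. -/
theorem mem_sup_span_singleton_zmod_two {V : Type*} [AddCommGroup V] [Module (ZMod 2) V]
    (J : Submodule (ZMod 2) V) (b x : V) :
    x ∈ J ⊔ Submodule.span (ZMod 2) {b} ↔ x ∈ J ∨ x + b ∈ J := by
  have hbb : b + b = 0 := ZModModule.add_self b
  constructor
  · intro hx
    obtain ⟨y, hy, z, hz, rfl⟩ := Submodule.mem_sup.mp hx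
    obtain ⟨k, rfl⟩ := Submodule.mem_span_singleton.mp hz
    have hk : ∀ k : ZMod 2, k = 0 ∨ k = 1 := by decide
    obtain rfl | rfl := hk k
    · left; simpa using hy
    · right; simpa [add_assoc, hbb] using hy
  · rintro (h | h)
    · exact Submodule.mem_sup_left h
    · have := Submodule.add_mem_sup h (Submodule.mem_span_singleton_self (R := ZMod 2) b)
      rwa [add_assoc, hbb, add_zero] at this

open scoped Classical in
/-- A sum over the span of `J` and `b ∉ J` splits over the cosets `J` and `J + b`. -/
theorem sum_ite_mem_sup_span_singleton {V M : Type*} [AddCommGroup V] [Module (ZMod 2) V]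
    [Fintype V] [AddCommMonoid M] (J : Submodule (ZMod 2) V) {b : V} (hb : b ∉ J) (f : V → M) :
    (∑ x, if x ∈ J ⊔ Submodule.span (ZMod 2) {b} then f x else 0) =
      ∑ x, if x ∈ J then f x + f (x + b) else 0 := by
  have hbb : b + b = 0 := ZModModule.add_self b
  have hsplit : ∀ x, (if x ∈ J ⊔ Submodule.span (ZMod 2) {b} then f x else 0) =
      (if x ∈ J then f x else 0) + if x + b ∈ J then f x else 0 := by
    intro x
    by_cases hx : x ∈ J
    · have hxb : x + b ∉ J := fun h => hb ((J.add_mem_iff_right hx).mp h)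
      simp [mem_sup_span_singleton_zmod_two, hx, hxb]
    · simp [mem_sup_span_singleton_zmod_two, hx]
  have hshift : (∑ x, if x + b ∈ J then f x else 0) = ∑ x, if x ∈ J then f (x + b) else 0 := by
    rw [← Equiv.sum_comp (Equiv.addRight b)]
    simp [add_assoc, hbb]
  rw [Finset.sum_congr rfl fun x _ => hsplit x, Finset.sum_add_distrib, hshift,
    ← Finset.sum_add_distrib]
  exact Finset.sum_congr rfl fun x _ => by split_ifs <;> simp

theorem card_sup_span_singleton_zmod_two {V : Type*} [AddCommGroup V] [Module (ZMod 2) V]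
    [Fintype V] (J : Submodule (ZMod 2) V) {b : V} (hb : b ∉ J) :
    Nat.card (J ⊔ Submodule.span (ZMod 2) {b} : Submodule (ZMod 2) V) = 2 * Nat.card J := by
  classical
  have hcard : ∀ K : Submodule (ZMod 2) V, Nat.card K = ∑ x, if x ∈ K then 1 else 0 := by
    intro K
    rw [Nat.card_eq_fintype_card, Fintype.card_subtype, Finset.card_filter]
  rw [hcard, hcard, sum_ite_mem_sup_span_singleton J hb, Finset.mul_sum]
  exact Finset.sum_congr rfl fun x _ => by split_ifs <;> rfl

/-- Compression of an operator commuting with the Pauli operator `T_b`. -/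
theorem pauliProj_mul_mul_of_commute {n : ℕ} {b : PhaseSpace n} (hsq : PauliT b * PauliT b = 1)
    (r : ZMod 2) {A : Matrix (Fin n → ZMod 2) (Fin n → ZMod 2) ℂ}
    (hA : PauliT b * A = A * PauliT b) :
    pauliProj b r * A * pauliProj b r = A * pauliProj b r := by
  have hs : (-1 : ℂ) ^ r.val * (-1) ^ r.val = 1 := by
    rw [← mul_pow]; simp
  have hAT : A * PauliT b * PauliT b = A := by rw [mul_assoc, hsq, mul_one]
  simp only [pauliProj, smul_mul_assoc, mul_smul_comm, add_mul, mul_add, one_mul, mul_one, hA, hAT,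
    smul_smul, smul_add]
  linear_combination (norm := module) ((4 : ℂ)⁻¹ * hs) • A

/-- Compression of an operator anticommuting with the Pauli operator `T_b`. -/
theorem pauliProj_mul_mul_of_anticommute {n : ℕ} {b : PhaseSpace n}
    (hsq : PauliT b * PauliT b = 1) (r : ZMod 2)
    {A : Matrix (Fin n → ZMod 2) (Fin n → ZMod 2) ℂ} (hA : PauliT b * A = -(A * PauliT b)) :
    pauliProj b r * A * pauliProj b r = 0 := by
  have hs : (-1 : ℂ) ^ r.val * (-1) ^ r.val = 1 := by
    rw [← mul_pow]; simp
  have hAT : A * PauliT b * PauliT b = A := by rw [mul_assoc, hsq, mul_one]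
  simp only [pauliProj, smul_mul_assoc, mul_smul_comm, add_mul, mul_add, one_mul, mul_one, hA, hAT,
    smul_smul, smul_add, neg_mul, smul_neg]
  linear_combination (norm := module) (-(4 : ℂ)⁻¹ * hs) • A

/-- For `b ∉ I`:
`Π_b^r Π_I^γ Π_b^r = (|I(b)|/|I|) Π_{I(b) ⊕ ⟨b⟩}^{γ∗r}`, where `I(b) = I ∩ ⟨b⟩^⊥` and
`γ∗r` is the value assignment on `I(b) + ⟨b⟩` extending `γ|_{I(b)}` with `γ∗r(b) = r`. -/
theorem pauliProj_stabProj_of_not_mem (n : ℕ) (I : Submodule (ZMod 2) (PhaseSpace n))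
    (hI : ∀ a ∈ I, ∀ b ∈ I, symplOmega a b = 0)
    (β : PhaseSpace n → PhaseSpace n → ZMod 2)
    (hβ : ∀ a b : PhaseSpace n, symplOmega a b = 0 →
      PauliT a * PauliT b = ((-1 : ℂ) ^ (β a b).val) • PauliT (a + b))
    (γ : PhaseSpace n → ZMod 2) (hγ0 : γ 0 = 0)
    (hγ : ∀ a ∈ I, ∀ b ∈ I, γ (a + b) = γ a + γ b + β a b)
    (b : PhaseSpace n) (hb : b ∉ I) (r : ZMod 2)
    (γ' : PhaseSpace n → ZMod 2) (hγ'0 : γ' 0 = 0)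
    (hγ' : ∀ x ∈ (I ⊓ symplPerp (Submodule.span (ZMod 2) {b})) ⊔ Submodule.span (ZMod 2) {b},
      ∀ y ∈ (I ⊓ symplPerp (Submodule.span (ZMod 2) {b})) ⊔ Submodule.span (ZMod 2) {b},
        γ' (x + y) = γ' x + γ' y + β x y)
    (hagree : ∀ x ∈ I ⊓ symplPerp (Submodule.span (ZMod 2) {b}), γ' x = γ x)
    (hγ'b : γ' b = r) :
    pauliProj b r * stabProj I γ * pauliProj b r =
      ((Nat.card (I ⊓ symplPerp (Submodule.span (ZMod 2) {b}) :
          Submodule (ZMod 2) (PhaseSpace n)) : ℂ) / (Nat.card I : ℂ)) •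
        stabProj ((I ⊓ symplPerp (Submodule.span (ZMod 2) {b})) ⊔ Submodule.span (ZMod 2) {b}) γ' := by
  classical
  set J := I ⊓ symplPerp (Submodule.span (ZMod 2) {b}) with hJ
  have hmemJ : ∀ a, a ∈ J ↔ a ∈ I ∧ symplOmega a b = 0 := fun a => by
    rw [hJ, Submodule.mem_inf, mem_symplPerp_span_singleton]
  have hbJ : b ∉ J := fun h => hb ((hmemJ b).mp h).1
  have hbK : b ∈ J ⊔ Submodule.span (ZMod 2) {b} :=
    Submodule.mem_sup_right (Submodule.mem_span_singleton_self b)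
  have hbb : b + b = 0 := ZModModule.add_self b
  have hβbb : β b b = 0 := by
    have h := hγ' b hbK b hbK
    rwa [hbb, hγ'0, CharTwo.add_self_eq_zero, zero_add, eq_comm] at h
  have hsq : PauliT b * PauliT b = 1 := by
    simp [hβ b b (symplOmega_self b), hβbb, hbb, PauliT_zero]
  have hterm : ∀ a : PhaseSpace n,
      pauliProj b r * (if a ∈ I then ((-1 : ℂ) ^ (γ a).val) • PauliT a else 0) * pauliProj b r =
        (2 : ℂ)⁻¹ • if a ∈ J then ((-1 : ℂ) ^ (γ' a).val) • PauliT a +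
          ((-1 : ℂ) ^ (γ' (a + b)).val) • PauliT (a + b) else 0 := by
    intro a
    by_cases haI : a ∈ I
    · by_cases hω : symplOmega a b = 0
      · have haJ : a ∈ J := (hmemJ a).mpr ⟨haI, hω⟩
        have hcomm : PauliT b * PauliT a = PauliT a * PauliT b := by
          simp [PauliT_mul_comm a b, hω]
        rw [if_pos haI, if_pos haJ, mul_smul_comm, smul_mul_assoc,
          pauliProj_mul_mul_of_commute hsq r hcomm, hγ' a (Submodule.mem_sup_left haJ) b hbK,
          hγ'b, hagree a haJ]
        simp only [pauliProj, mul_smul_comm, mul_add, mul_one, hβ a b hω, neg_one_pow_val_add]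
        module
      · have hω1 : symplOmega a b = 1 := Fin.eq_one_of_ne_zero _ hω
        have hanti : PauliT b * PauliT a = -(PauliT a * PauliT b) := by
          simp [PauliT_mul_comm a b, hω1, ZMod.val_one]
        have haJ : a ∉ J := fun h => hω ((hmemJ a).mp h).2
        rw [if_pos haI, if_neg haJ, mul_smul_comm, smul_mul_assoc,
          pauliProj_mul_mul_of_anticommute hsq r hanti, smul_zero, smul_zero]
    · have haJ : a ∉ J := fun h => haI ((hmemJ a).mp h).1
      simp [haI, haJ]
  have hJ0 : (Nat.card J : ℂ) ≠ 0 := Nat.cast_ne_zero.mpr Nat.card_pos.ne'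
  unfold stabProj
  rw [sum_ite_mem_sup_span_singleton J hbJ, card_sup_span_singleton_zmod_two J hbJ,
    mul_smul_comm, smul_mul_assoc, Finset.mul_sum, Finset.sum_mul,
    Finset.sum_congr rfl fun a _ => hterm a, ← Finset.smul_sum, smul_smul, smul_smul]
  congr 1
  push_cast
  field_simp
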